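/- Main theorem (quantitative form): there exists an absolute constant c > 0 such that for every dimension d ≥ 2, every finite collection 𝒞 of axis-parallel closed cubes in ℝ^d admits a pairwise disjoint subcollection 𝒮 with |∪_{Q∈𝒮} Q| ≥ c·2^{-d}/(d·log d)·|∪_{Q∈𝒞} Q|. -/

import Mathlib

open MeasureTheory

/-- The axis-parallel closed cube with corner `x` and side `s`. -/
def cube {d : ℕ} (p : (Fin d → ℝ) × ℝ) : Set (Fin d → ℝ) :=
  Set.univ.pi fun j => Set.Icc (p.1 j) (p.1 j + p.2)

lemma mem_cube {d : ℕ} {p : (Fin d → ℝ) × ℝ} {x : Fin d → ℝ} :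
    x ∈ cube p ↔ ∀ j, p.1 j ≤ x j ∧ x j ≤ p.1 j + p.2 := by
  simp only [cube, Set.mem_univ_pi, Set.mem_Icc]

lemma measurableSet_cube {d : ℕ} (p : (Fin d → ℝ) × ℝ) : MeasurableSet (cube p) :=
  MeasurableSet.univ_pi fun _ => measurableSet_Icc

lemma volume_cube {d : ℕ} (p : (Fin d → ℝ) × ℝ) :
    volume (cube p) = ENNReal.ofReal p.2 ^ d := by
  rw [cube, volume_pi_pi]
  simp

lemma volume_cube_ne_top {d : ℕ} (p : (Fin d → ℝ) × ℝ) : volume (cube p) ≠ ⊤ := by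
  rw [volume_cube]
  exact ENNReal.pow_ne_top ENNReal.ofReal_ne_top

lemma volume_real_cube {d : ℕ} {p : (Fin d → ℝ) × ℝ} (hp : 0 ≤ p.2) :
    volume.real (cube p) = p.2 ^ d := by
  simp [measureReal_def, volume_cube, ENNReal.toReal_ofReal hp]

lemma volume_biUnion_cube_ne_top {d : ℕ} (𝒞 : Finset ((Fin d → ℝ) × ℝ)) :
    volume (⋃ p ∈ 𝒞, cube p) ≠ ⊤ :=
  (measure_biUnion_lt_top 𝒞.finite_toSet fun p _ => (volume_cube_ne_top p).lt_top).ne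

/-- A set meeting every translate of the lattice `L • ℤ^d` in at most `K` points has measure at
most `K * L ^ d`. -/
lemma volume_le_of_lattice_card_le {d : ℕ} {E : Set (Fin d → ℝ)} (hE : MeasurableSet E) {L : ℝ}
    (hL : 0 < L) {K : ℕ}
    (h : ∀ (x : Fin d → ℝ) (V : Finset (Fin d → ℤ)),
      (∀ v ∈ V, (fun j => x j + L * v j) ∈ E) → V.card ≤ K) :
    volume E ≤ K * ENNReal.ofReal L ^ d := by
  set F : Set (Fin d → ℝ) := Set.univ.pi fun _ => Set.Ico 0 L
  have hF : MeasurableSet F := MeasurableSet.univ_pi fun _ => measurableSet_Ico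
  have hFvol : volume F = ENNReal.ofReal L ^ d := by simp [F, volume_pi_pi]
  let τ : (Fin d → ℤ) → (Fin d → ℝ) → (Fin d → ℝ) := fun v x => x + fun j => L * v j
  have hτ : ∀ v, MeasurePreserving (τ v) volume volume := fun v =>
    measurePreserving_add_right volume _
  have hτE : ∀ v, MeasurableSet (τ v ⁻¹' E) := fun v => (hτ v).measurable hE
  have hτF : ∀ v : Fin d → ℤ, MeasurableSet ((fun x => x - fun j => L * (v j : ℝ)) ⁻¹' F) := fun v =>
    (measurable_id.sub_const _) hF
  have hcover : E ⊆ ⋃ v : Fin d → ℤ, E ∩ (fun x => x - fun j => L * (v j : ℝ)) ⁻¹' F := by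
    intro x hx
    refine Set.mem_iUnion.2 ⟨fun j => ⌊x j / L⌋, hx, ?_⟩
    intro j _
    have h1 := Int.floor_le (x j / L)
    have h2 := Int.lt_floor_add_one (x j / L)
    rw [le_div_iff₀ hL] at h1
    rw [div_lt_iff₀ hL] at h2
    constructor <;> simp only [Pi.sub_apply] <;> linarith
  calc volume E
      ≤ ∑' v : Fin d → ℤ, volume (E ∩ (fun x => x - fun j => L * (v j : ℝ)) ⁻¹' F) :=
        (measure_mono hcover).trans (measure_iUnion_le _)
    _ = ∑' v : Fin d → ℤ, ∫⁻ x in F, (τ v ⁻¹' E).indicator 1 x := by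
        refine tsum_congr fun v => ?_
        rw [lintegral_indicator_one (hτE v), Measure.restrict_apply (hτE v),
          ← (hτ v).measure_preimage (hE.inter (hτF v)).nullMeasurableSet]
        congr 1
        ext x
        simp [τ]
    _ = ∫⁻ x in F, ∑' v : Fin d → ℤ, (τ v ⁻¹' E).indicator 1 x :=
        (lintegral_tsum fun v => (measurable_one.indicator (hτE v)).aemeasurable).symm
    _ ≤ ∫⁻ _ in F, K := by
        refine lintegral_mono fun x => ENNReal.summable.tsum_le_of_sum_le fun V => ?_
        classical
        simp only [Set.indicator_apply, Pi.one_apply, Finset.sum_boole]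
        exact_mod_cast h x _ fun v hv => (Finset.mem_filter.1 hv).2
    _ = K * ENNReal.ofReal L ^ d := by
        rw [setLIntegral_const, hFvol]

/-- Cubes with sides less than `L / 2` admit a disjoint subcollection of cardinality at least
`L ^ (-d)` times the measure of their union. -/
lemma exists_disjoint_card_mul_pow {d : ℕ} (𝒞 : Finset ((Fin d → ℝ) × ℝ)) {L : ℝ} (hL : 0 < L)
    (h𝒞 : ∀ p ∈ 𝒞, 2 * p.2 < L) :
    ∃ 𝒮 ⊆ 𝒞, ((𝒮 : Set ((Fin d → ℝ) × ℝ)).Pairwise fun p q => Disjoint (cube p) (cube q)) ∧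
      volume.real (⋃ p ∈ 𝒞, cube p) ≤ 𝒮.card * L ^ d := by
  classical
  obtain ⟨𝒮, h𝒮, hmax⟩ := Finset.exists_max_image
    (𝒞.powerset.filter fun 𝒮 : Finset ((Fin d → ℝ) × ℝ) => (𝒮 : Set ((Fin d → ℝ) × ℝ)).Pairwise
      fun p q => Disjoint (cube p) (cube q)) Finset.card ⟨∅, by simp⟩
  rw [Finset.mem_filter, Finset.mem_powerset] at h𝒮
  refine ⟨𝒮, h𝒮.1, h𝒮.2, ?_⟩
  have key : volume (⋃ p ∈ 𝒞, cube p) ≤ 𝒮.card * ENNReal.ofReal L ^ d := by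
    refine volume_le_of_lattice_card_le
      (Finset.measurableSet_biUnion _ fun p _ => measurableSet_cube p) hL fun x V hV => ?_
    have hV' : ∀ v ∈ V, ∃ p ∈ 𝒞, (fun j => x j + L * (v j : ℝ)) ∈ cube p := fun v hv => by
      simpa using hV v hv
    choose! f hf𝒞 hf using hV'
    have heq : ∀ v ∈ V, ∀ w ∈ V, ∀ y, y ∈ cube (f v) → y ∈ cube (f w) → v = w := by
      intro v hv w hw y hyv hyw
      funext j
      have h1 := mem_cube.1 hyv j
      have h2 := mem_cube.1 hyw j
      have h3 := mem_cube.1 (hf v hv) j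
      have h4 := mem_cube.1 (hf w hw) j
      have h5 := h𝒞 _ (hf𝒞 v hv)
      have h6 := h𝒞 _ (hf𝒞 w hw)
      have h7 : L * ((v j : ℝ) - w j) < L * 1 := by linarith
      have h8 : L * ((w j : ℝ) - v j) < L * 1 := by linarith
      have h9 := lt_of_mul_lt_mul_left h7 hL.le
      have h10 := lt_of_mul_lt_mul_left h8 hL.le
      have h11 : v j - w j < 1 := by exact_mod_cast h9
      have h12 : w j - v j < 1 := by exact_mod_cast h10
      omega
    have hinj : Set.InjOn f V := fun v hv w hw hvw =>
      heq v hv w hw _ (hf v hv) (hvw ▸ hf v hv)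
    rw [← Finset.card_image_of_injOn hinj]
    refine hmax _ (Finset.mem_filter.2 ⟨Finset.mem_powerset.2 ?_, ?_⟩)
    · exact Finset.image_subset_iff.2 hf𝒞
    · intro p hp q hq hpq
      obtain ⟨v, hv, rfl⟩ := Finset.mem_image.1 hp
      obtain ⟨w, hw, rfl⟩ := Finset.mem_image.1 hq
      refine Set.disjoint_left.2 fun y hyv hyw => hpq ?_
      rw [heq v hv w hw y hyv hyw]
  have := ENNReal.toReal_mono (by finiteness) key
  simpa [measureReal_def, ENNReal.toReal_ofReal hL.le] using this

/-- Cubes of nearly equal sides admit a disjoint subcollection covering a proportion close to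
`2 ^ (-d)`. -/
lemma exists_disjoint_of_side_le_mul {d : ℕ} {a : ℝ} (ha : 1 < a)
    (𝒞 : Finset ((Fin d → ℝ) × ℝ)) (hpos : ∀ p ∈ 𝒞, 0 < p.2)
    (h𝒞 : ∀ p ∈ 𝒞, ∀ q ∈ 𝒞, p.2 ≤ a * q.2) :
    ∃ 𝒮 ⊆ 𝒞, ((𝒮 : Set ((Fin d → ℝ) × ℝ)).Pairwise fun p q => Disjoint (cube p) (cube q)) ∧
      volume.real (⋃ p ∈ 𝒞, cube p) ≤ (2 * a ^ 2) ^ d * ∑ p ∈ 𝒮, p.2 ^ d := by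
  rcases 𝒞.eq_empty_or_nonempty with rfl | hne
  · exact ⟨∅, by simp, by simp, by simp⟩
  obtain ⟨m, hm, hmin⟩ := 𝒞.exists_min_image Prod.snd hne
  have hm0 := hpos m hm
  obtain ⟨𝒮, hsub, hdisj, hvol⟩ := exists_disjoint_card_mul_pow 𝒞
    (L := 2 * a ^ 2 * m.2) (by positivity) fun p hp => by
      have := h𝒞 p hp m hm
      have : a * m.2 < a * (a * m.2) := by
        gcongr
        exact lt_mul_of_one_lt_left hm0 ha
      linarith
  refine ⟨𝒮, hsub, hdisj, hvol.trans ?_⟩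
  rw [mul_pow _ m.2, mul_left_comm, ← nsmul_eq_mul]
  gcongr
  exact Finset.card_nsmul_le_sum _ _ _ fun p hp =>
    pow_le_pow_left₀ hm0.le (hmin p (hsub hp)) d

/-- If the sides of the cubes are nearly equal within each scale `k` and decrease by a factor `t`
between different scales, then there is a disjoint subcollection of proportional measure. -/
lemma exists_disjoint_of_separated_scales {d : ℕ} {a t : ℝ} (ha : 1 < a) (ht : 0 ≤ t)
    (k : (Fin d → ℝ) × ℝ → ℤ) (𝒞 : Finset ((Fin d → ℝ) × ℝ)) (hpos : ∀ p ∈ 𝒞, 0 < p.2)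
    (heq : ∀ p ∈ 𝒞, ∀ q ∈ 𝒞, k p = k q → p.2 ≤ a * q.2)
    (hlt : ∀ p ∈ 𝒞, ∀ q ∈ 𝒞, k q < k p → q.2 ≤ t * p.2) :
    ∃ 𝒮 ⊆ 𝒞, ((𝒮 : Set ((Fin d → ℝ) × ℝ)).Pairwise fun p q => Disjoint (cube p) (cube q)) ∧
      volume.real (⋃ p ∈ 𝒞, cube p) ≤
        ((2 * a ^ 2) ^ d + (1 + 2 * t) ^ d) * ∑ p ∈ 𝒮, p.2 ^ d := by
  classical
  induction 𝒞 using Finset.strongInduction with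
  | H 𝒞 ih =>
    rcases 𝒞.eq_empty_or_nonempty with rfl | hne
    · exact ⟨∅, by simp, by simp, by simp⟩
    obtain ⟨m, hm, hmax⟩ := 𝒞.exists_max_image k hne
    set T := 𝒞.filter fun p => k p = k m with hT
    have hTsub : T ⊆ 𝒞 := Finset.filter_subset _ _
    have hTk : ∀ p ∈ T, k p = k m := fun p hp => (Finset.mem_filter.1 hp).2
    obtain ⟨𝒮₀, hsub₀, hdisj₀, hvol₀⟩ := exists_disjoint_of_side_le_mul ha T
      (fun p hp => hpos p (hTsub hp))
      fun p hp q hq => heq p (hTsub hp) q (hTsub hq) ((hTk p hp).trans (hTk q hq).symm)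
    set 𝒞' := 𝒞.filter fun q => k q < k m ∧ ∀ p ∈ 𝒮₀, Disjoint (cube p) (cube q) with h𝒞'
    have hsub' : 𝒞' ⊆ 𝒞 := Finset.filter_subset _ _
    have hss : 𝒞' ⊂ 𝒞 := Finset.filter_ssubset.2 ⟨m, hm, fun h => lt_irrefl _ h.1⟩
    obtain ⟨𝒮', hsubS, hdisj', hvol'⟩ := ih 𝒞' hss (fun p hp => hpos p (hsub' hp))
      (fun p hp q hq => heq p (hsub' hp) q (hsub' hq))
      (fun p hp q hq => hlt p (hsub' hp) q (hsub' hq))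
    have hcross : ∀ p ∈ 𝒮₀, ∀ q ∈ 𝒮', Disjoint (cube p) (cube q) := fun p hp q hq =>
      (Finset.mem_filter.1 (hsubS hq)).2.2 p hp
    have hdisjS : Disjoint 𝒮₀ 𝒮' := Finset.disjoint_left.2 fun p hp hp' =>
      (Finset.mem_filter.1 (hsubS hp')).2.1.ne (hTk p (hsub₀ hp))
    refine ⟨𝒮₀ ∪ 𝒮', Finset.union_subset (hsub₀.trans hTsub) (hsubS.trans hsub'), ?_, ?_⟩
    · rw [Finset.coe_union, Set.pairwise_union]
      exact ⟨hdisj₀, hdisj', fun p hp q hq _ => ⟨hcross p hp q hq, (hcross p hp q hq).symm⟩⟩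
    let e : (Fin d → ℝ) × ℝ → (Fin d → ℝ) × ℝ := fun p =>
      (fun j => p.1 j - t * p.2, (1 + 2 * t) * p.2)
    have hcover : (⋃ p ∈ 𝒞, cube p) ⊆
        ((⋃ p ∈ T, cube p) ∪ ⋃ p ∈ 𝒮₀, cube (e p)) ∪ ⋃ p ∈ 𝒞', cube p := by
      refine Set.iUnion₂_subset fun q hq => ?_
      rcases (hmax q hq).eq_or_lt with hqm | hqm
      · exact (Set.subset_biUnion_of_mem (u := cube)
          (show q ∈ (T : Set _) from Finset.mem_filter.2 ⟨hq, hqm⟩)).trans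
          (Set.subset_union_left.trans Set.subset_union_left)
      by_cases hd : ∀ p ∈ 𝒮₀, Disjoint (cube p) (cube q)
      · exact (Set.subset_biUnion_of_mem (u := cube)
          (show q ∈ (𝒞' : Set _) from Finset.mem_filter.2 ⟨hq, hqm, hd⟩)).trans
          Set.subset_union_right
      · push Not at hd
        obtain ⟨p, hp, hpq⟩ := hd
        obtain ⟨y, hyp, hyq⟩ := Set.not_disjoint_iff.1 hpq
        have hside := hlt p (hTsub (hsub₀ hp)) q hq (by rwa [hTk p (hsub₀ hp)])
        refine fun x hx => Or.inl (Or.inr (Set.mem_iUnion₂.2 ⟨p, hp, mem_cube.2 fun j => ?_⟩))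
        have h1 := mem_cube.1 hyp j
        have h2 := mem_cube.1 hyq j
        have h3 := mem_cube.1 hx j
        constructor <;> simp only [e] <;> linarith
    have hexp : volume.real (⋃ p ∈ 𝒮₀, cube (e p)) ≤ (1 + 2 * t) ^ d * ∑ p ∈ 𝒮₀, p.2 ^ d := by
      refine (measureReal_biUnion_finset_le _ _).trans_eq ?_
      rw [Finset.mul_sum]
      refine Finset.sum_congr rfl fun p hp => ?_
      have := hpos p (hTsub (hsub₀ hp))
      rw [volume_real_cube (by positivity), mul_pow]
    have htop : volume (((⋃ p ∈ T, cube p) ∪ ⋃ p ∈ 𝒮₀, cube (e p)) ∪ ⋃ p ∈ 𝒞', cube p) ≠ ⊤ :=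
      measure_union_ne_top (measure_union_ne_top (volume_biUnion_cube_ne_top _)
        (measure_biUnion_lt_top 𝒮₀.finite_toSet fun p _ => (volume_cube_ne_top _).lt_top).ne)
        (volume_biUnion_cube_ne_top _)
    have h1 := measureReal_mono hcover htop
    have h2 := measureReal_union_le (μ := volume)
      ((⋃ p ∈ T, cube p) ∪ ⋃ p ∈ 𝒮₀, cube (e p)) (⋃ p ∈ 𝒞', cube p)
    have h3 := measureReal_union_le (μ := volume) (⋃ p ∈ T, cube p) (⋃ p ∈ 𝒮₀, cube (e p))
    rw [Finset.sum_union hdisjS]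
    linarith

/-- A finite family of sets, classified modulo `M`, has a class whose union has at least `1 / M`
of the total measure. -/
lemma exists_residue_volume_le {d : ℕ} (𝒞 : Finset ((Fin d → ℝ) × ℝ))
    (k : (Fin d → ℝ) × ℝ → ℤ) {M : ℕ} (hM : 0 < M) :
    ∃ r : ℤ, volume.real (⋃ p ∈ 𝒞, cube p) ≤
      M * volume.real (⋃ p ∈ 𝒞.filter fun p => k p % M = r, cube p) := by
  classical
  obtain ⟨r, -, hmax⟩ := (Finset.Ico (0 : ℤ) M).exists_max_image
    (fun r => volume.real (⋃ p ∈ 𝒞.filter fun p => k p % M = r, cube p))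
    ⟨0, by simpa using hM⟩
  refine ⟨r, ?_⟩
  have hcover : (⋃ p ∈ 𝒞, cube p) ⊆
      ⋃ r ∈ Finset.Ico (0 : ℤ) M, ⋃ p ∈ 𝒞.filter fun p => k p % M = r, cube p := by
    intro x hx
    obtain ⟨p, hp, hxp⟩ := Set.mem_iUnion₂.1 hx
    have hM' : (0 : ℤ) < M := by exact_mod_cast hM
    exact Set.mem_iUnion₂.2 ⟨k p % M,
      Finset.mem_Ico.2 ⟨Int.emod_nonneg _ hM'.ne', Int.emod_lt_of_pos _ hM'⟩,
      Set.mem_iUnion₂.2 ⟨p, Finset.mem_filter.2 ⟨hp, rfl⟩, hxp⟩⟩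
  calc volume.real (⋃ p ∈ 𝒞, cube p)
      ≤ volume.real
          (⋃ r ∈ Finset.Ico (0 : ℤ) M, ⋃ p ∈ 𝒞.filter fun p => k p % M = r, cube p) :=
        measureReal_mono hcover (measure_biUnion_lt_top (Finset.finite_toSet _)
          fun r _ => (volume_biUnion_cube_ne_top _).lt_top).ne
    _ ≤ _ := measureReal_biUnion_finset_le _ _
    _ ≤ _ := Finset.sum_le_card_nsmul _ _ _ hmax
    _ = _ := by simp

lemma volume_real_biUnion_cube {d : ℕ} {𝒮 : Finset ((Fin d → ℝ) × ℝ)} (hpos : ∀ p ∈ 𝒮, 0 < p.2)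
    (hdisj : (𝒮 : Set ((Fin d → ℝ) × ℝ)).Pairwise fun p q => Disjoint (cube p) (cube q)) :
    volume.real (⋃ p ∈ 𝒮, cube p) = ∑ p ∈ 𝒮, p.2 ^ d := by
  rw [measureReal_biUnion_finset hdisj (fun p _ => measurableSet_cube p)
    fun p _ => volume_cube_ne_top p]
  exact Finset.sum_congr rfl fun p hp => volume_real_cube (hpos p hp).le

/-- The number of scales of ratio `1 + 1 / d` needed to reach a ratio `d` is `O(d log d)`. -/
lemma exists_nat_le_one_add_inv_pow {d : ℕ} (hd : 2 ≤ d) :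
    ∃ n : ℕ, (d : ℝ) ≤ (1 + (d : ℝ)⁻¹) ^ n ∧ (n : ℝ) + 1 ≤ 4 * (d * Real.log d) := by
  have hd2 : (2 : ℝ) ≤ d := by exact_mod_cast hd
  have hd0 : (0 : ℝ) < d := by linarith
  have hlog : 1 / 2 ≤ Real.log d := by
    have := Real.log_two_gt_d9
    have := Real.log_le_log two_pos hd2
    linarith
  have hmul : 1 ≤ d * Real.log d := by nlinarith
  refine ⟨⌈2 * (d * Real.log d)⌉₊, ?_, ?_⟩
  · have hla : 1 / (2 * d) ≤ Real.log (1 + (d : ℝ)⁻¹) := by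
      refine le_trans ?_ (Real.one_sub_inv_le_log_of_pos (by positivity))
      have : 1 - (1 + (d : ℝ)⁻¹)⁻¹ = 1 / (d + 1) := by
        field_simp
        ring
      rw [this]
      gcongr
      linarith
    rw [← Real.log_le_log_iff hd0 (by positivity), Real.log_pow]
    calc Real.log d = 2 * (d * Real.log d) * (1 / (2 * d)) := by field_simp
      _ ≤ _ := by
        gcongr
        exact Nat.le_ceil _
  · have := Nat.ceil_lt_add_one (a := 2 * (d * Real.log d)) (by positivity)
    linarith

lemma two_mul_sq_pow_add_pow_le {d : ℕ} (hd : 2 ≤ d) :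
    (2 * (1 + (d : ℝ)⁻¹) ^ 2) ^ d + (1 + 2 * (d : ℝ)⁻¹) ^ d ≤ 2 * Real.exp 2 * 2 ^ d := by
  have hd0 : (d : ℝ) ≠ 0 := by positivity
  have h1 : (1 + 2 * (d : ℝ)⁻¹) ^ d ≤ Real.exp 2 := by
    calc (1 + 2 * (d : ℝ)⁻¹) ^ d ≤ Real.exp (2 * (d : ℝ)⁻¹) ^ d := by
          gcongr
          linarith [Real.add_one_le_exp (2 * (d : ℝ)⁻¹)]
      _ = Real.exp 2 := by
          rw [← Real.exp_nat_mul]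
          congr 1
          field_simp
  have h2 : ((1 + (d : ℝ)⁻¹) ^ 2) ^ d ≤ Real.exp 2 := by
    calc ((1 + (d : ℝ)⁻¹) ^ 2) ^ d ≤ (Real.exp (d : ℝ)⁻¹ ^ 2) ^ d := by
          gcongr
          linarith [Real.add_one_le_exp (d : ℝ)⁻¹]
      _ = Real.exp 2 := by
          rw [← pow_mul, ← Real.exp_nat_mul]
          congr 1
          push_cast
          field_simp
  have h3 : (1 : ℝ) ≤ 2 ^ d := one_le_pow₀ one_le_two
  rw [mul_pow]
  nlinarith [Real.exp_pos 2]

/-- Main theorem: there is an absolute constant `c > 0` such that for every `d ≥ 2`, every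
finite collection of axis-parallel closed cubes in ℝ^d admits a pairwise disjoint
subcollection whose union has measure at least `c·2^{-d}/(d log d)` times that of the
union of the whole collection. -/
theorem stmt_19 :
    ∃ c : ℝ, 0 < c ∧ ∀ d : ℕ, 2 ≤ d →
      ∀ 𝒞 : Finset ((Fin d → ℝ) × ℝ), (∀ p ∈ 𝒞, 0 < p.2) →
        ∃ 𝒮 ⊆ 𝒞,
          ((𝒮 : Set ((Fin d → ℝ) × ℝ)).Pairwise fun p q => Disjoint (cube p) (cube q)) ∧
          c * ((2 : ℝ) ^ d)⁻¹ / (d * Real.log d) * (volume (⋃ p ∈ 𝒞, cube p)).toReal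
            ≤ (volume (⋃ p ∈ 𝒮, cube p)).toReal := by
  refine ⟨(8 * Real.exp 2)⁻¹, by positivity, fun d hd 𝒞 hpos => ?_⟩
  have hd1 : (1 : ℝ) < d := by exact_mod_cast hd
  have hlog : 0 < Real.log d := Real.log_pos hd1
  have hd0 : (0 : ℝ) < d := by linarith
  obtain ⟨n, hn, hnle⟩ := exists_nat_le_one_add_inv_pow hd
  set a : ℝ := 1 + (d : ℝ)⁻¹ with ha_def
  have ha : 1 < a := lt_add_of_pos_right _ (by positivity)
  have ha0 : 0 < a := by positivity
  have hscale : ∀ p ∈ 𝒞, ∃ m : ℤ, a ^ m ≤ p.2 ∧ p.2 < a ^ (m + 1) := fun p hp =>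
    exists_mem_Ico_zpow (hpos p hp) ha
  choose! k hk_le hk_lt using hscale
  obtain ⟨r, hr⟩ := exists_residue_volume_le 𝒞 k n.succ_pos
  set 𝒞' := 𝒞.filter fun p => k p % (n.succ : ℕ) = r
  have hsub' : 𝒞' ⊆ 𝒞 := Finset.filter_subset _ _
  obtain ⟨𝒮, hsub, hdisj, hvol⟩ := exists_disjoint_of_separated_scales ha
    (inv_nonneg.2 hd0.le) k 𝒞' (fun p hp => hpos p (hsub' hp))
    (fun p hp q hq hpq => by
      have h1 := hk_lt p (hsub' hp)
      have h2 := hk_le q (hsub' hq)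
      rw [hpq, zpow_add_one₀ ha0.ne'] at h1
      nlinarith)
    (fun p hp q hq hpq => by
      have hmod : k q % (n.succ : ℕ) = k p % (n.succ : ℕ) :=
        (Finset.mem_filter.1 hq).2.trans (Finset.mem_filter.1 hp).2.symm
      have hgap : k q + 1 + n ≤ k p := by
        have h1 := Int.le_of_dvd (sub_pos.2 hpq) (Int.ModEq.dvd hmod)
        push_cast at h1
        linarith
      have hq2 := hk_lt q (hsub' hq)
      have hq0 := hpos q (hsub' hq)
      rw [le_inv_mul_iff₀ hd0]
      calc d * q.2 ≤ a ^ n * a ^ (k q + 1) := by gcongr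
        _ = a ^ (k q + 1 + n) := by rw [zpow_add₀ ha0.ne' _ (n : ℤ), zpow_natCast, mul_comm]
        _ ≤ a ^ k p := zpow_le_zpow_right₀ ha.le hgap
        _ ≤ p.2 := hk_le p (hsub' hp))
  refine ⟨𝒮, hsub.trans hsub', hdisj, ?_⟩
  rw [← measureReal_def, ← measureReal_def]
  rw [← volume_real_biUnion_cube (fun p hp => hpos p (hsub' (hsub hp))) hdisj] at hvol
  have hbound : volume.real (⋃ p ∈ 𝒞, cube p) ≤
      4 * (d * Real.log d) * (2 * Real.exp 2 * 2 ^ d * volume.real (⋃ p ∈ 𝒮, cube p)) := by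
    refine hr.trans (mul_le_mul (by push_cast; exact hnle) (hvol.trans ?_)
      measureReal_nonneg (by positivity))
    gcongr
    exact two_mul_sq_pow_add_pow_le hd
  calc (8 * Real.exp 2)⁻¹ * ((2 : ℝ) ^ d)⁻¹ / (d * Real.log d) * volume.real (⋃ p ∈ 𝒞, cube p)
      ≤ (8 * Real.exp 2)⁻¹ * ((2 : ℝ) ^ d)⁻¹ / (d * Real.log d) *
        (4 * (d * Real.log d) * (2 * Real.exp 2 * 2 ^ d * volume.real (⋃ p ∈ 𝒮, cube p))) := by
        gcongr
    _ = volume.real (⋃ p ∈ 𝒮, cube p) := by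
        field_simp
        norm_num
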